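/- Strong completeness of the STIT imagination logic L: if Θ is an L-consistent set of sentences, then Θ has a model, i.e., there is an imagination model M and a moment-history pair m/h of M such that M, m/h ⊨ A for every A ∈ Θ. -/

import Mathlib

set_option maxHeartbeats 1000000

/-! Syntax: countably many variables (indexed by ℕ), Booleans (⊥, →),
    modalities `S` (box), `[c]_a` (cstit) and `I_a` (imag) for agents in `Agent`. -/

inductive Form (Agent : Type) : Type
  | var : ℕ → Form Agent
  | fls : Form Agent
  | imp : Form Agent → Form Agent → Form Agent
  | box : Form Agent → Form Agent
  | cstit : Agent → Form Agent → Form Agent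
  | imag : Agent → Form Agent → Form Agent

namespace Form

variable {Agent : Type}

def neg (A : Form Agent) : Form Agent := A.imp .fls

def conj (A B : Form Agent) : Form Agent := (A.imp B.neg).neg

def fiff (A B : Form Agent) : Form Agent := (A.imp B).conj (B.imp A)

/-- `P`, the dual of `S`. -/
def pos (A : Form Agent) : Form Agent := A.neg.box.neg

/-- The dual of `[c]_a`. -/
def posC (a : Agent) (A : Form Agent) : Form Agent := (Form.cstit a A.neg).neg

def verum : Form Agent := (Form.fls : Form Agent).neg

end Form

def listConj {Agent : Type} : List (Form Agent) → Form Agent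
  | [] => Form.verum
  | A :: l => A.conj (listConj l)

/-- Propositional tautologies: true under every Boolean valuation treating
    variables and modalized formulas as atoms. -/
def Tautology {Agent : Type} (A : Form Agent) : Prop :=
  ∀ v : Form Agent → Prop, ¬ v .fls → (∀ B C : Form Agent, v (B.imp C) ↔ (v B → v C)) → v A

/-- The Hilbert system L: (A0) tautologies, (A1) S is S5, (A2) each [c]_a is S5,
    (A3) SA → [c]_aA, (A4) independence axiom, (A5) imagination-as-action axiom;
    rules: modus ponens, S-necessitation, replacement of equivalents under I_a. -/
inductive Prov {Agent : Type} : Form Agent → Prop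
  | taut {A : Form Agent} : Tautology A → Prov A
  | sK (A B : Form Agent) : Prov ((A.imp B).box.imp (A.box.imp B.box))
  | sT (A : Form Agent) : Prov (A.box.imp A)
  | s5 (A : Form Agent) : Prov (A.pos.imp A.pos.box)
  | cK (a : Agent) (A B : Form Agent) :
      Prov ((Form.cstit a (A.imp B)).imp ((Form.cstit a A).imp (Form.cstit a B)))
  | cT (a : Agent) (A : Form Agent) : Prov ((Form.cstit a A).imp A)
  | c5 (a : Agent) (A : Form Agent) :
      Prov ((Form.posC a A).imp (Form.cstit a (Form.posC a A)))
  | a3 (a : Agent) (A : Form Agent) : Prov (A.box.imp (Form.cstit a A))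
  | a4 (l : List (Agent × Form Agent)) (hne : l ≠ []) (hnd : (l.map Prod.fst).Nodup) :
      Prov ((listConj (l.map fun p => (Form.cstit p.1 p.2).pos)).imp
        (listConj (l.map fun p => Form.cstit p.1 p.2)).pos)
  | a5 (a : Agent) (A : Form Agent) :
      Prov ((Form.imag a A).imp ((Form.cstit a (Form.imag a A)).conj (Form.imag a A).box.neg))
  | mp {A B : Form Agent} : Prov (A.imp B) → Prov A → Prov B
  | necS {A : Form Agent} : Prov A → Prov A.box
  | reI (a : Agent) {A B : Form Agent} :
      Prov (A.fiff B) → Prov ((Form.imag a A).fiff (Form.imag a B))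

/-- A set is L-consistent iff no finite conjunction of its members derives a contradiction. -/
def Consistent {Agent : Type} (Γ : Set (Form Agent)) : Prop :=
  ¬ ∃ l : List (Form Agent), (∀ A ∈ l, A ∈ Γ) ∧ Prov ((listConj l).imp .fls)

/-- L-maxiconsistent: L-consistent and maximal among L-consistent sets. -/
def MaxConsistent {Agent : Type} (w : Set (Form Agent)) : Prop :=
  Consistent w ∧ ∀ Γ : Set (Form Agent), Consistent Γ → w ⊆ Γ → Γ = w

/-- Σ = {¬p : p ∈ Var} ∪ {SA ↔ A} ∪ {[c]_aA ↔ A}. -/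
def SigmaSet (Agent : Type) : Set (Form Agent) :=
  {φ | (∃ n : ℕ, φ = (Form.var n : Form Agent).neg) ∨
       (∃ A : Form Agent, φ = A.box.fiff A) ∨
       (∃ (a : Agent) (A : Form Agent), φ = (Form.cstit a A).fiff A)}

/-! Semantics: imagination models and satisfaction. -/

/-- The raw data of an imagination model (frame conditions separated out below). -/
structure PreModel (Agent : Type) where
  Tree : Type
  le : Tree → Tree → Prop
  Choice : Tree → Agent → Set (Set (Set Tree))
  N : Agent → Tree → Set Tree → Set (Set (Tree × Set Tree))
  V : ℕ → Set (Tree × Set Tree)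

namespace PreModel

variable {Agent : Type} (M : PreModel Agent)

/-- Histories are maximal chains. -/
def IsHist (h : Set M.Tree) : Prop := IsMaxChain M.le h

/-- The set of histories passing through `m`. -/
def Hm (m : M.Tree) : Set (Set M.Tree) := {h | M.IsHist h ∧ m ∈ h}

/-- `Choice^m_a(h)`: the histories lying in the same choice cell as `h` at `m`. -/
def Cell (m : M.Tree) (a : Agent) (h : Set M.Tree) : Set (Set M.Tree) :=
  {h' | ∃ e ∈ M.Choice m a, h ∈ e ∧ h' ∈ e}

/-- Satisfaction at a moment-history pair. -/
def Sat : Form Agent → M.Tree → Set M.Tree → Prop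
  | .var n, m, h => (m, h) ∈ M.V n
  | .fls, _, _ => False
  | .imp A B, m, h => Sat A m h → Sat B m h
  | .box A, m, h => ∀ h' ∈ M.Hm m, Sat A m h'
  | .cstit a A, m, h => ∀ h' ∈ M.Cell m a h, Sat A m h'
  | .imag a A, m, h =>
      (∀ h' ∈ M.Cell m a h,
        {p : M.Tree × Set M.Tree | M.IsHist p.2 ∧ p.1 ∈ p.2 ∧ Sat A p.1 p.2} ∈ M.N a m h') ∧
      (∃ h'' ∈ M.Hm m,
        {p : M.Tree × Set M.Tree | M.IsHist p.2 ∧ p.1 ∈ p.2 ∧ Sat A p.1 p.2} ∉ M.N a m h'')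

end PreModel

/-- An imagination model: the raw data together with all frame conditions. -/
structure IModel (Agent : Type) extends PreModel Agent where
  tree_nonempty : Nonempty Tree
  le_refl : ∀ x, le x x
  le_antisymm : ∀ x y, le x y → le y x → x = y
  le_trans : ∀ x y z, le x y → le y z → le x z
  lower_bound : ∀ m1 m2, ∃ m, le m m1 ∧ le m m2
  past_linear : ∀ m m1 m2, le m1 m → le m2 m → le m1 m2 ∨ le m2 m1
  choice_cells_nonempty : ∀ m a, ∀ e ∈ Choice m a, e.Nonempty
  choice_cover : ∀ m a, ⋃₀ (Choice m a) = toPreModel.Hm m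
  choice_disjoint : ∀ m a, ∀ e ∈ Choice m a, ∀ e' ∈ Choice m a, e ≠ e' → e ∩ e' = ∅
  no_choice_between_undivided : ∀ m a, ∀ e ∈ Choice m a, ∀ h h',
      h ∈ toPreModel.Hm m → h' ∈ toPreModel.Hm m → h ∈ e →
      (∃ m', (le m m' ∧ m ≠ m') ∧ m' ∈ h ∧ m' ∈ h') → h' ∈ e
  independence : ∀ m (f : Agent → Set (Set Tree)), (∀ a, f a ∈ Choice m a) →
      (⋂ a, f a).Nonempty

/-! The canonical model. -/

section Canonical

variable {Agent : Type}

/-- wRw' iff {A : SA ∈ w} ⊆ w'. -/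
def CanR (w w' : Set (Form Agent)) : Prop := ∀ A : Form Agent, A.box ∈ w → A ∈ w'

/-- w ≃_a w' iff {A : [c]_aA ∈ w} ⊆ w'. -/
def CanC (a : Agent) (w w' : Set (Form Agent)) : Prop :=
  ∀ A : Form Agent, Form.cstit a A ∈ w → A ∈ w'

/-- The R-class of a maxiconsistent set. -/
def RCls (w : Set (Form Agent)) : Set (Set (Form Agent)) :=
  {w' | MaxConsistent w' ∧ CanR w w'}

/-- Ξ: the set of R-equivalence classes. -/
def Xi (Agent : Type) : Set (Set (Set (Form Agent))) :=
  {X | ∃ w, MaxConsistent w ∧ X = RCls w}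

/-- E(X,a): the ≃_a-equivalence classes within X. -/
def ECls (X : Set (Set (Form Agent))) (a : Agent) : Set (Set (Set (Form Agent))) :=
  {e | ∃ w ∈ X, e = {w' ∈ X | CanC a w w'}}

/-- Raw canonical points: the fresh root `none`, classes `some (inl X)`, worlds `some (inr w)`. -/
def CPoint (Agent : Type) : Type := Option (Set (Set (Form Agent)) ⊕ Set (Form Agent))

/-- Tree = {0} ∪ Ξ ∪ W. -/
def CTreeSet (Agent : Type) : Set (CPoint Agent) :=
  {x | x = none ∨ (∃ X ∈ Xi Agent, x = some (Sum.inl X)) ∨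
       (∃ w, MaxConsistent w ∧ x = some (Sum.inr w))}

def CTree (Agent : Type) : Type := {x : CPoint Agent // x ∈ CTreeSet Agent}

/-- x ≤ y iff x = y or y ∈ x or x = 0. -/
def CLe (x y : CTree Agent) : Prop :=
  x = y ∨ (∃ X w, x.1 = some (Sum.inl X) ∧ y.1 = some (Sum.inr w) ∧ w ∈ X) ∨ x.1 = none

/-- h_w = {0, X, w}. -/
def CHistX (X : Set (Set (Form Agent))) (w : Set (Form Agent)) : Set (CTree Agent) :=
  {x | x.1 = none ∨ x.1 = some (Sum.inl X) ∨ x.1 = some (Sum.inr w)}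

def IsClsMoment (m : CTree Agent) : Prop := ∃ X, m.1 = some (Sum.inl X)

/-- The canonical choice function: vacuous outside Ξ, induced by E(X,a) at X ∈ Ξ. -/
def CChoice (m : CTree Agent) (a : Agent) : Set (Set (Set (CTree Agent))) :=
  {H | (¬ IsClsMoment m ∧ H = {h | IsMaxChain CLe h ∧ m ∈ h}) ∨
       (∃ X, m.1 = some (Sum.inl X) ∧ ∃ e ∈ ECls X a,
          H = {h | ∃ w ∈ e, h = CHistX X w})}

/-- Ext(A): {X/h_w : w ∈ X ∈ Ξ, A ∈ w}, augmented by all pairs m/h_w with m ∉ Ξ, m ∈ h_w,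
    in case A belongs to the maxiconsistent extension of Σ. -/
def CExt (A : Form Agent) : Set (CTree Agent × Set (CTree Agent)) :=
  {p | ∃ X w, X ∈ Xi Agent ∧ w ∈ X ∧ A ∈ w ∧
        p.1.1 = some (Sum.inl X) ∧ p.2 = CHistX X w} ∪
  {p | (∃ w0, MaxConsistent w0 ∧ SigmaSet Agent ⊆ w0 ∧ A ∈ w0) ∧
        ∃ X w, X ∈ Xi Agent ∧ w ∈ X ∧ p.2 = CHistX X w ∧
          ¬ IsClsMoment p.1 ∧ p.1 ∈ p.2}

/-- N_a(X/h_w) = {Ext A : I_aA ∈ w}; empty at moments outside Ξ. -/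
def CN (a : Agent) (m : CTree Agent) (h : Set (CTree Agent)) :
    Set (Set (CTree Agent × Set (CTree Agent))) :=
  {P | ∃ X w, m.1 = some (Sum.inl X) ∧ X ∈ Xi Agent ∧ w ∈ X ∧ h = CHistX X w ∧
        ∃ A, Form.imag a A ∈ w ∧ P = CExt A}

/-- V(p) = {X/h_w : w ∈ X ∈ Ξ, p ∈ w}. -/
def CV (Agent : Type) (n : ℕ) : Set (CTree Agent × Set (CTree Agent)) :=
  {p | ∃ X w, X ∈ Xi Agent ∧ w ∈ X ∧ Form.var n ∈ w ∧
        p.1.1 = some (Sum.inl X) ∧ p.2 = CHistX X w}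

/-- The canonical model (raw data). -/
def CanModel (Agent : Type) : PreModel Agent where
  Tree := CTree Agent
  le := CLe
  Choice := CChoice
  N := CN
  V := CV Agent

/-- The canonical moment corresponding to a class X ∈ Ξ. -/
def clsMoment {X : Set (Set (Form Agent))} (hX : X ∈ Xi Agent) : CTree Agent :=
  ⟨some (Sum.inl X), Or.inr (Or.inl ⟨X, hX, rfl⟩)⟩

end Canonical

namespace SC

variable {Agent : Type}

def BV (v : Form Agent → Prop) : Prop :=
  ¬ v .fls ∧ ∀ B C : Form Agent, v (B.imp C) ↔ (v B → v C)

theorem BV.neg {v : Form Agent → Prop} (h : BV v) (A : Form Agent) : v A.neg ↔ ¬ v A := by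
  unfold Form.neg; rw [h.2]; simp [h.1]

theorem BV.conj {v : Form Agent → Prop} (h : BV v) (A B : Form Agent) :
    v (A.conj B) ↔ v A ∧ v B := by
  unfold Form.conj; rw [h.neg, h.2, h.neg]; tauto

theorem BV.fiff {v : Form Agent → Prop} (h : BV v) (A B : Form Agent) :
    v (A.fiff B) ↔ (v A ↔ v B) := by
  unfold Form.fiff; rw [h.conj, h.2, h.2]; tauto

theorem BV.listConj {v : Form Agent → Prop} (h : BV v) (l : List (Form Agent)) :
    v (listConj l) ↔ ∀ A ∈ l, v A := by
  induction l with
  | nil => simp [_root_.listConj, Form.verum, h.neg, h.1]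
  | cons A l ih => simp [_root_.listConj, h.conj, ih]

theorem tautP {A : Form Agent} (h : ∀ v : Form Agent → Prop, BV v → v A) : Prov A :=
  Prov.taut fun v h1 h2 => h v ⟨h1, h2⟩

inductive Der (Γ : Set (Form Agent)) : Form Agent → Prop
  | ax {A} : A ∈ Γ → Der Γ A
  | pr {A} : Prov A → Der Γ A
  | mp {A B} : Der Γ (A.imp B) → Der Γ A → Der Γ B

theorem Der.list {Γ : Set (Form Agent)} {A} (h : Der Γ A) :
    ∃ l : List (Form Agent), (∀ B ∈ l, B ∈ Γ) ∧ Prov ((listConj l).imp A) := by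
  induction h with
  | @ax A h =>
    refine ⟨[A], by simpa using h, tautP fun v hv => ?_⟩
    rw [hv.2, hv.listConj]; simp
  | @pr A h =>
    refine ⟨[], by simp, Prov.mp (tautP fun v hv => ?_) h⟩
    rw [hv.2, hv.2]; tauto
  | @mp A B _ _ ih1 ih2 =>
    obtain ⟨l1, h1, p1⟩ := ih1
    obtain ⟨l2, h2, p2⟩ := ih2
    refine ⟨l1 ++ l2, ?_, Prov.mp (Prov.mp (tautP fun v hv => ?_) p1) p2⟩
    · intro B hB
      rcases List.mem_append.1 hB with h | h
      exacts [h1 _ h, h2 _ h]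
    · simp only [hv.2, hv.listConj, List.mem_append]
      intro a b c
      exact a (fun x hx => c x (Or.inl hx)) (b (fun x hx => c x (Or.inr hx)))

theorem Der.empty {A : Form Agent} (h : Der ∅ A) : Prov A := by
  induction h with
  | ax h => exact absurd h (by simp)
  | pr h => exact h
  | mp _ _ h1 h2 => exact h1.mp h2

theorem Der.ded {Γ : Set (Form Agent)} {A B} (h : Der (insert A Γ) B) : Der Γ (A.imp B) := by
  induction h with
  | @ax C h =>
    rcases h with rfl | h
    · exact .pr (tautP fun v hv => by rw [hv.2]; exact id)
    · exact .mp (.pr (tautP fun v hv => by simp only [hv.2]; tauto)) (.ax h)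
  | @pr C h => exact .mp (.pr (tautP fun v hv => by simp only [hv.2]; tauto)) (.pr h)
  | @mp C D _ _ h1 h2 =>
    exact .mp (.mp (.pr (tautP fun v hv => by simp only [hv.2]; tauto)) h1) h2

theorem Der.mono {Γ Δ : Set (Form Agent)} (hs : Γ ⊆ Δ) {A} (h : Der Γ A) : Der Δ A := by
  induction h with
  | ax h => exact .ax (hs h)
  | pr h => exact .pr h
  | mp _ _ h1 h2 => exact h1.mp h2

theorem Der.chain {c : Set (Set (Form Agent))} (hc : IsChain (· ⊆ ·) c) (hne : c.Nonempty)
    {A} (h : Der (⋃₀ c) A) : ∃ Γ ∈ c, Der Γ A := by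
  induction h with
  | ax h =>
    obtain ⟨Γ, h1, h2⟩ := h
    exact ⟨Γ, h1, .ax h2⟩
  | pr h => exact ⟨hne.some, hne.some_mem, .pr h⟩
  | mp _ _ h1 h2 =>
    obtain ⟨Γ, g1, g2⟩ := h1
    obtain ⟨Δ, d1, d2⟩ := h2
    rcases hc.total g1 d1 with h | h
    · exact ⟨Δ, d1, (g2.mono h).mp d2⟩
    · exact ⟨Γ, g1, g2.mp (d2.mono h)⟩

def W (Agent : Type) : Type :=
  {v : Form Agent → Prop // BV v ∧ ∀ A, Prov A → v A}

theorem lind {Γ : Set (Form Agent)} (h : ¬ Der Γ .fls) : ∃ w : W Agent, ∀ A ∈ Γ, w.1 A := by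
  obtain ⟨Δ, hΓΔ, hΔ⟩ := zorn_subset_nonempty {Δ : Set (Form Agent) | ¬ Der Δ .fls} (by
    intro c hc1 hc2 hne
    refine ⟨⋃₀ c, ?_, fun s hs => Set.subset_sUnion_of_mem hs⟩
    intro hd
    obtain ⟨Δ, h1, h2⟩ := hd.chain hc2 hne
    exact hc1 h1 h2) Γ h
  have hcon : ¬ Der Δ .fls := hΔ.prop
  have key : ∀ A, Der Δ A → A ∈ Δ := by
    intro A hA
    have : ¬ Der (insert A Δ) .fls := fun h' => hcon (h'.ded.mp hA)
    exact hΔ.le_of_ge this (Set.subset_insert _ _) (Set.mem_insert _ _)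
  have key2 : ∀ A, A ∉ Δ → A.neg ∈ Δ := by
    intro A hA
    by_contra hn
    have : ¬ Der (insert A Δ) .fls := fun h' => hn (key _ h'.ded)
    exact hA (hΔ.le_of_ge this (Set.subset_insert _ _) (Set.mem_insert _ _))
  refine ⟨⟨fun A => A ∈ Δ, ⟨fun h => hcon (.ax h), fun B C => ⟨fun h1 h2 => ?_, fun h1 => ?_⟩⟩,
    fun A hA => key _ (.pr hA)⟩, fun A hA => hΓΔ hA⟩
  · exact key _ (.mp (.ax h1) (.ax h2))
  · by_cases hB : B ∈ Δ
    · exact key _ (.mp (.pr (tautP fun v hv => by simp only [hv.2]; tauto)) (.ax (h1 hB)))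
    · refine key _ (.mp (.pr (tautP fun v hv => ?_)) (.ax (key2 _ hB)))
      simp only [hv.2, hv.neg]; tauto

theorem prov_of_all {A : Form Agent} (h : ∀ w : W Agent, w.1 A) : Prov A := by
  by_contra hn
  have : ¬ Der {A.neg} .fls := by
    intro hd
    have hd' : Der (insert A.neg ∅) .fls := hd.mono (by simp)
    refine hn (Prov.mp (tautP fun v hv => ?_) hd'.ded.empty)
    simp only [hv.2, hv.neg]
    have := hv.1
    tauto
  obtain ⟨w, hw⟩ := lind this
  exact (w.2.1.neg A).1 (hw _ rfl) (h w)

theorem W.mp (w : W Agent) {A B : Form Agent} (h : Prov (A.imp B)) : w.1 A → w.1 B :=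
  (w.2.1.2 _ _).1 (w.2.2 _ h)

structure S5 (b : Form Agent → Form Agent) : Prop where
  K : ∀ A B, Prov ((b (A.imp B)).imp ((b A).imp (b B)))
  T : ∀ A, Prov ((b A).imp A)
  five : ∀ A : Form Agent, Prov ((b A.neg).neg.imp (b (b A.neg).neg))
  nec : ∀ A, Prov A → Prov (b A)

theorem s5box : S5 (Form.box : Form Agent → Form Agent) :=
  ⟨Prov.sK, Prov.sT, Prov.s5, fun _ => Prov.necS⟩

theorem s5c (a : Agent) : S5 (Form.cstit a) :=
  ⟨Prov.cK a, Prov.cT a, Prov.c5 a, fun A h => (Prov.a3 a A).mp (Prov.necS h)⟩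

theorem S5.k {b : Form Agent → Form Agent} (hb : S5 b) (w : W Agent) {A B} (h : w.1 (b (A.imp B))) (h2 : w.1 (b A)) : w.1 (b B) :=
  (w.2.1.2 _ _).1 (w.mp (hb.K A B) h) h2

theorem S5.mono {b : Form Agent → Form Agent} (hb : S5 b) (w : W Agent) {A B} (h : Prov (A.imp B)) (h2 : w.1 (b A)) : w.1 (b B) :=
  hb.k w (w.2.2 _ (hb.nec _ h)) h2

theorem S5.nb {b : Form Agent → Form Agent} (hb : S5 b) (w : W Agent) (A) (h : ¬ w.1 (b A)) : w.1 (b (b A).neg) := by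
  have h1 : ¬ w.1 (b A.neg.neg) := fun h' => h (hb.mono w
    (tautP fun v hv => by simp only [hv.2, hv.neg]; tauto) h')
  have h2 := w.mp (hb.five A.neg) ((w.2.1.neg _).2 h1)
  refine hb.mono w (prov_of_all fun u => ?_) h2
  simp only [u.2.1.2, u.2.1.neg]
  exact fun h3 h4 => h3 (hb.mono u (tautP fun v hv => by simp only [hv.2, hv.neg]; tauto) h4)

theorem S5.four {b : Form Agent → Form Agent} (hb : S5 b) (w : W Agent) (A) (h : w.1 (b A)) : w.1 (b (b A)) := by
  have h1 : ¬ w.1 (b (b A).neg) := fun h' => (w.2.1.neg _).1 (w.mp (hb.T _) h') h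
  refine hb.mono w (prov_of_all fun u => ?_) (hb.nb w _ h1)
  simp only [u.2.1.2, u.2.1.neg]
  intro h3
  by_contra h4
  exact h3 (hb.nb u _ h4)

theorem S5.der {b : Form Agent → Form Agent} (hb : S5 b) (w : W Agent) {A} (h : Der {B | w.1 (b B)} A) : w.1 (b A) := by
  induction h with
  | ax h => exact h
  | pr h => exact w.2.2 _ (hb.nec _ h)
  | mp _ _ h1 h2 => exact hb.k w h1 h2

theorem S5.E {b : Form Agent → Form Agent} (hb : S5 b) (w u : W Agent) (h : ∀ A, w.1 (b A) → u.1 A) (A) : w.1 (b A) ↔ u.1 (b A) := by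
  constructor
  · exact fun h1 => h _ (hb.four w _ h1)
  · intro h1
    by_contra h2
    exact (u.2.1.neg _).1 (h _ (hb.nb w _ h2)) h1

theorem S5.ex {b : Form Agent → Form Agent} (hb : S5 b) (w : W Agent) (A) (h : ¬ w.1 (b A)) :
    ∃ u : W Agent, (∀ B, w.1 (b B) ↔ u.1 (b B)) ∧ ¬ u.1 A := by
  have : ¬ Der (insert A.neg {B | w.1 (b B)}) .fls := by
    intro hd
    refine h (hb.mono w ?_ (hb.der w hd.ded))
    refine tautP fun v hv => ?_
    simp only [hv.2, hv.neg]
    have := hv.1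
    tauto
  obtain ⟨u, hu⟩ := lind this
  exact ⟨u, hb.E w u fun B hB => hu _ (Or.inr hB), (u.2.1.neg _).1 (hu _ (Or.inl rfl))⟩

instance st (Agent : Type) : Setoid (W Agent) where
  r w u := ∀ A, w.1 (Form.box A) ↔ u.1 (Form.box A)
  iseqv := ⟨fun _ _ => Iff.rfl, fun h A => (h A).symm, fun h g A => (h A).trans (g A)⟩

def Ec (a : Agent) (w u : W Agent) : Prop := ∀ A, w.1 (Form.cstit a A) ↔ u.1 (Form.cstit a A)

theorem Ec.box {a : Agent} {w u : W Agent} (h : Ec a w u) : w ≈ u := by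
  have : ∀ {w u : W Agent}, Ec a w u → ∀ A, w.1 (Form.box A) → u.1 (Form.box A) := by
    intro w u h A h1
    exact u.mp (Prov.cT a _) ((h _).1 (w.mp (Prov.a3 a _) (s5box.four w _ h1)))
  exact fun A => ⟨this h A, this (fun B => (h B).symm) A⟩

theorem indep [Fintype Agent] [Nonempty Agent] (w : W Agent) (f : Agent → W Agent)
    (hf : ∀ a, w ≈ f a) : ∃ u : W Agent, w ≈ u ∧ ∀ a, Ec a (f a) u := by
  classical
  have key : ∀ A, Der ({A | w.1 (Form.box A)} ∪
      {B | ∃ a C, B = Form.cstit a C ∧ (f a).1 (Form.cstit a C)}) A →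
      ∃ g : Agent → Form Agent, (∀ a, (f a).1 (Form.cstit a (g a))) ∧
        ∀ u : W Agent, w ≈ u → (∀ a, u.1 (Form.cstit a (g a))) → u.1 A := by
    intro A hA
    have hver : Prov (Form.verum : Form Agent) := tautP fun v hv => by
      unfold Form.verum; rw [hv.neg]; exact hv.1
    induction hA with
    | @ax A h =>
      rcases h with h | ⟨a, C, rfl, h⟩
      · exact ⟨fun _ => Form.verum, fun a => (f a).2.2 _ ((s5c a).nec _ hver),
          fun u hu _ => u.mp (Prov.sT A) ((hu A).1 h)⟩
      · refine ⟨fun a' => if a' = a then C else Form.verum, fun a' => ?_, fun u hu h' => ?_⟩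
        · by_cases e : a' = a
          · subst e; simpa using h
          · simpa [e] using (f a').2.2 _ ((s5c a').nec _ hver)
        · simpa using h' a
    | @pr A h =>
      exact ⟨fun _ => Form.verum, fun a => (f a).2.2 _ ((s5c a).nec _ hver),
          fun u hu _ => u.2.2 _ h⟩
    | @mp A B _ _ h1 h2 =>
      obtain ⟨g1, a1, b1⟩ := h1
      obtain ⟨g2, a2, b2⟩ := h2
      refine ⟨fun a => (g1 a).conj (g2 a), fun a => ?_, fun u hu h => ?_⟩
      · refine (s5c a).k _ ((s5c a).mono _ ?_ (a1 a)) (a2 a)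
        exact tautP fun v hv => by simp only [hv.2, hv.conj]; tauto
      · refine (u.2.1.2 _ _).1 (b1 u hu fun a => (s5c a).mono u ?_ (h a))
          (b2 u hu fun a => (s5c a).mono u ?_ (h a))
        · exact tautP fun v hv => by simp only [hv.2, hv.conj]; tauto
        · exact tautP fun v hv => by simp only [hv.2, hv.conj]; tauto
  have con : ¬ Der ({A | w.1 (Form.box A)} ∪
      {B | ∃ a C, B = Form.cstit a C ∧ (f a).1 (Form.cstit a C)}) .fls := by
    intro hd
    obtain ⟨g, h1, h2⟩ := key _ hd
    have h4 := w.mp (Prov.a4 ((Finset.univ : Finset Agent).toList.map fun a => (a, g a))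
      (by simp [Finset.univ_eq_empty_iff]) (by
        rw [List.map_map]
        simpa [Function.comp_def] using Finset.nodup_toList (Finset.univ : Finset Agent))) (by
        rw [w.2.1.listConj]
        simp only [List.map_map, List.mem_map, Finset.mem_toList, Finset.mem_univ, true_and,
          Function.comp]
        rintro _ ⟨a, rfl⟩
        unfold Form.pos
        rw [w.2.1.neg]
        intro h
        exact ((f a).2.1.neg _).1 ((f a).mp (Prov.sT _) ((hf a _).1 h)) (h1 a))
    unfold Form.pos at h4
    rw [w.2.1.neg] at h4
    obtain ⟨u, hu1, hu2⟩ := s5box.ex w _ h4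
    rw [u.2.1.neg, not_not, u.2.1.listConj] at hu2
    refine u.2.1.1 (h2 u hu1 fun a => hu2 _ ?_)
    simp
  obtain ⟨u, hu⟩ := lind con
  refine ⟨u, s5box.E w u fun A hA => hu _ (Or.inl hA), fun a => (s5c a).E _ _ fun A hA => ?_⟩
  exact u.mp (Prov.cT a A) (hu _ (Or.inr ⟨a, A, rfl, hA⟩))

inductive Tr (Agent : Type) : Type
  | root : Tr Agent
  | cls : Quotient (st Agent) → Tr Agent
  | leaf : W Agent → Tr Agent

def Tr.le : Tr Agent → Tr Agent → Prop
  | .root, _ => True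
  | .cls q, .cls q' => q = q'
  | .cls q, .leaf w => q = ⟦w⟧
  | .leaf w, .leaf w' => w = w'
  | _, _ => False

def hist (w : W Agent) : Set (Tr Agent) := {x | x.le (.leaf w)}

theorem le_trans' (x y z : Tr Agent) (h1 : x.le y) (h2 : y.le z) : x.le z := by
  cases x <;> cases y <;> cases z <;> simp_all [Tr.le]

theorem past (m x y : Tr Agent) (h1 : x.le m) (h2 : y.le m) : x.le y ∨ y.le x := by
  cases x <;> cases y <;> cases m <;> simp_all [Tr.le]

theorem le_refl' (x : Tr Agent) : x.le x := by cases x <;> simp [Tr.le]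

theorem htot {s : Set (Tr Agent)} (hs : IsChain Tr.le s) {x y} (hx : x ∈ s) (hy : y ∈ s) :
    x.le y ∨ y.le x := by
  by_cases h : x = y
  · subst h; exact Or.inl (le_refl' _)
  · exact hs hx hy h

theorem hist_max (w : W Agent) : IsMaxChain Tr.le (hist w) := by
  refine ⟨fun x hx y hy _ => past _ x y hx hy, fun t ht hs => hs.antisymm fun x hx => ?_⟩
  have hl : Tr.leaf w ∈ t := hs (le_refl' (Tr.leaf w) : Tr.leaf w ∈ hist w)
  rcases htot ht hx hl with h | h
  · exact h
  · cases x <;> simp_all [Tr.le, hist]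

theorem max_hist [Nonempty (W Agent)] {h : Set (Tr Agent)} (hh : IsMaxChain Tr.le h) :
    ∃ w, h = hist w := by
  suffices ∃ w, h ⊆ hist w by
    obtain ⟨w, hw⟩ := this
    exact ⟨w, hh.2 (hist_max w).1 hw⟩
  by_cases h1 : ∃ w, Tr.leaf w ∈ h
  · obtain ⟨w, hw⟩ := h1
    refine ⟨w, fun x hx => ?_⟩
    rcases htot hh.1 hx hw with h | h
    · exact h
    · cases x <;> simp_all [Tr.le, hist]
  · by_cases h2 : ∃ w, Tr.cls ⟦w⟧ ∈ h
    · obtain ⟨w, hw⟩ := h2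
      refine ⟨w, fun x hx => ?_⟩
      rcases htot hh.1 hx hw with h | h
      · cases x <;> simp_all [Tr.le, hist]
      · cases x <;> simp_all [Tr.le, hist]
    · refine ⟨Classical.arbitrary _, fun x hx => ?_⟩
      cases x with
      | root => trivial
      | cls q =>
        induction q using Quotient.inductionOn with
        | _ w => exact (h2 ⟨w, hx⟩).elim
      | leaf w => exact (h1 ⟨w, hx⟩).elim

theorem hist_inj {w u : W Agent} (h : hist w = hist u) : w = u := by
  have : Tr.leaf w ∈ hist u := h ▸ (le_refl' (Tr.leaf w) : Tr.leaf w ∈ hist w)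
  exact this

def Rel (a : Agent) : Tr Agent → W Agent → W Agent → Prop
  | .cls _, w, u => Ec a w u
  | _, _, _ => True

theorem Rel.refl (a : Agent) (m) (w) : Rel a m w w := by
  cases m <;> simp [Rel, Ec]
theorem Rel.symm {a : Agent} {m} {w u} (h : Rel a m w u) : Rel a m u w := by
  cases m <;> simp_all [Rel, Ec]
theorem Rel.trans {a : Agent} {m} {w u v} (h : Rel a m w u) (g : Rel a m u v) : Rel a m w v := by
  cases m <;> simp_all [Rel, Ec]

def cell (a : Agent) (m : Tr Agent) (w : W Agent) : Set (Set (Tr Agent)) :=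
  {h | ∃ u, h = hist u ∧ m ∈ hist u ∧ Rel a m w u}

theorem cell_eq {a : Agent} {m : Tr Agent} {w u : W Agent} (h : Rel a m w u) :
    cell a m w = cell a m u := by
  ext x
  constructor
  · rintro ⟨v, rfl, h1, h2⟩; exact ⟨v, rfl, h1, h.symm.trans h2⟩
  · rintro ⟨v, rfl, h1, h2⟩; exact ⟨v, rfl, h1, h.trans h2⟩

def PM (Agent : Type) : PreModel Agent where
  Tree := Tr Agent
  le := Tr.le
  Choice m a := {e | ∃ w, m ∈ hist w ∧ e = cell a m w}
  N a m h := {P | ∃ w : W Agent, m = .cls ⟦w⟧ ∧ h = hist w ∧ ∃ A, w.1 (.imag a A) ∧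
    ∀ u : W Agent, ((Tr.cls ⟦u⟧, hist u) : Tr Agent × Set (Tr Agent)) ∈ P ↔ u.1 A}
  V n := {p | ∃ w : W Agent, p = (.cls ⟦w⟧, hist w) ∧ w.1 (.var n)}

theorem Hm_iff [Nonempty (W Agent)] (m : Tr Agent) (h : Set (Tr Agent)) :
    h ∈ (PM Agent).Hm m ↔ ∃ w, h = hist w ∧ m ∈ hist w := by
  constructor
  · rintro ⟨h1, h2⟩
    obtain ⟨w, rfl⟩ := max_hist h1
    exact ⟨w, rfl, h2⟩
  · rintro ⟨w, rfl, h⟩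
    exact ⟨hist_max w, h⟩

theorem mem_hist (m : Tr Agent) [Nonempty (W Agent)] : ∃ w, m ∈ hist w := by
  cases m with
  | root => exact ⟨Classical.arbitrary _, trivial⟩
  | cls q =>
    induction q using Quotient.inductionOn with
    | _ w => exact ⟨w, rfl⟩
  | leaf w => exact ⟨w, rfl⟩

def IM (Agent : Type) [Fintype Agent] [Nonempty (W Agent)] : IModel Agent where
  toPreModel := PM Agent
  tree_nonempty := ⟨Tr.root⟩
  le_refl := le_refl'
  le_antisymm x y h1 h2 := by
    change Tr.le x y at h1
    change Tr.le y x at h2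
    cases x <;> cases y <;> simp_all [Tr.le] <;> rfl
  le_trans := le_trans'
  lower_bound m1 m2 := ⟨Tr.root, trivial, trivial⟩
  past_linear := past
  choice_cells_nonempty := by
    rintro m a _ ⟨w, h, rfl⟩
    exact ⟨hist w, w, rfl, h, Rel.refl _ _ _⟩
  choice_cover := by
    intro m a
    ext h
    refine Iff.trans ?_ (Hm_iff _ _).symm
    constructor
    · rintro ⟨_, ⟨w, h1, rfl⟩, ⟨u, rfl, h2, _⟩⟩
      exact ⟨u, rfl, h2⟩
    · rintro ⟨w, rfl, h⟩
      exact ⟨_, ⟨w, h, rfl⟩, w, rfl, h, Rel.refl _ _ _⟩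
  choice_disjoint := by
    rintro m a _ ⟨w, h1, rfl⟩ _ ⟨u, h2, rfl⟩ hne
    by_contra hn
    obtain ⟨_, ⟨v, rfl, _, hv⟩, ⟨v', e, _, hv'⟩⟩ := Set.nonempty_iff_ne_empty.2 hn
    cases hist_inj e
    exact hne (cell_eq (hv.trans hv'.symm))
  no_choice_between_undivided := by
    rintro m a _ ⟨w, h1, rfl⟩ h h' hm hm' ⟨u, rfl, hu, hr⟩ ⟨m', ⟨hle, hne⟩, g1, g2⟩
    obtain ⟨v, rfl, hv⟩ := (Hm_iff _ _).1 hm'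
    refine ⟨v, rfl, hv, hr.trans ?_⟩
    change Tr.le m m' at hle
    change Tr.le m' _ at g1
    change Tr.le m' _ at g2
    cases m with
    | root => trivial
    | leaf _ => trivial
    | cls q =>
      cases m' with
      | root => exact hle.elim
      | cls q' => exact (hne (congrArg Tr.cls hle)).elim
      | leaf x =>
        cases (g1 : x = u)
        cases (g2 : u = v)
        exact Rel.refl _ _ _
  independence := by
    intro m f hf
    choose g hg1 hg2 using hf
    suffices ∃ u, m ∈ hist u ∧ ∀ a, Rel a m (g a) u by
      obtain ⟨u, h1, h2⟩ := this
      refine ⟨hist u, Set.mem_iInter.2 fun a => ?_⟩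
      rw [hg2]
      exact ⟨u, rfl, h1, h2 a⟩
    obtain ⟨w, hw⟩ := mem_hist (Agent := Agent) m
    rcases isEmpty_or_nonempty Agent with hE | hE
    · exact ⟨w, hw, fun a => hE.elim a⟩
    cases m with
    | root => exact ⟨w, hw, fun _ => trivial⟩
    | leaf _ => exact ⟨w, hw, fun _ => trivial⟩
    | cls q =>
      cases (hw : q = ⟦w⟧)
      obtain ⟨u, h1, h2⟩ := indep w g fun a => Quotient.exact (hg1 a)
      exact ⟨u, Quotient.sound h1, h2⟩

theorem cell_iff (a : Agent) (w : W Agent) (h : Set (Tr Agent)) :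
    h ∈ (PM Agent).Cell (.cls ⟦w⟧) a (hist w) ↔ ∃ u, h = hist u ∧ Ec a w u := by
  constructor
  · rintro ⟨_, ⟨v, _, rfl⟩, ⟨u, e, _, hu⟩, ⟨x, rfl, _, hx⟩⟩
    cases hist_inj e
    exact ⟨x, rfl, fun A => (hu A).symm.trans (hx A)⟩
  · rintro ⟨u, rfl, hu⟩
    exact ⟨_, ⟨w, rfl, rfl⟩, ⟨w, rfl, rfl, fun _ => Iff.rfl⟩, ⟨u, rfl, Quotient.sound hu.box, hu⟩⟩

theorem imag_congr {a : Agent} {A B : Form Agent} (h : ∀ u : W Agent, u.1 A ↔ u.1 B)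
    (w : W Agent) : w.1 (.imag a A) ↔ w.1 (.imag a B) :=
  (w.2.1.fiff _ _).1 (w.2.2 _ (Prov.reI a (prov_of_all fun u => (u.2.1.fiff _ _).2 (h u))))

theorem truth [Nonempty (W Agent)] (A : Form Agent) :
    ∀ w : W Agent, (PM Agent).Sat A (.cls ⟦w⟧) (hist w) ↔ w.1 A := by
  induction A with
  | var n =>
    intro w
    constructor
    · rintro ⟨u, e, h⟩
      cases hist_inj (Prod.ext_iff.1 e).2
      exact h
    · exact fun h => ⟨w, rfl, h⟩
  | fls => exact fun w => ⟨fun h => h.elim, fun h => w.2.1.1 h⟩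
  | imp A B ihA ihB =>
    intro w
    rw [w.2.1.2, ← ihA, ← ihB]
    rfl
  | box A ih =>
    intro w
    constructor
    · intro h
      by_contra hn
      obtain ⟨u, h1, h2⟩ := s5box.ex w A hn
      have e : (⟦w⟧ : Quotient (st Agent)) = ⟦u⟧ := Quotient.sound h1
      refine h2 ((ih u).1 ?_)
      rw [← e]
      exact h _ ((Hm_iff _ _).2 ⟨u, rfl, e⟩)
    · intro h h' hh'
      obtain ⟨u, rfl, e⟩ := (Hm_iff _ _).1 hh'
      have e : (⟦w⟧ : Quotient (st Agent)) = ⟦u⟧ := e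
      rw [e]
      exact (ih u).2 (u.mp (Prov.sT A) ((Quotient.exact e A).1 h))
  | cstit a A ih =>
    intro w
    constructor
    · intro h
      by_contra hn
      obtain ⟨u, h1, h2⟩ := (s5c a).ex w A hn
      have e : (⟦w⟧ : Quotient (st Agent)) = ⟦u⟧ := Quotient.sound (Ec.box h1)
      refine h2 ((ih u).1 ?_)
      rw [← e]
      exact h _ ((cell_iff _ _ _).2 ⟨u, rfl, h1⟩)
    · intro h h' hh'
      obtain ⟨u, rfl, h1⟩ := (cell_iff _ _ _).1 hh'
      have e : (⟦w⟧ : Quotient (st Agent)) = ⟦u⟧ := Quotient.sound (Ec.box h1)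
      rw [e]
      exact (ih u).2 (u.mp (Prov.cT a A) ((h1 A).1 h))
  | imag a A ih =>
    intro w
    have key : ∀ u : W Agent, w ≈ u →
        ({p : (PM Agent).Tree × Set (PM Agent).Tree | (PM Agent).IsHist p.2 ∧ p.1 ∈ p.2 ∧
          (PM Agent).Sat A p.1 p.2} ∈ (PM Agent).N a (Tr.cls ⟦w⟧) (hist u) ↔
          u.1 (.imag a A)) := by
      intro u hu
      have e : (⟦w⟧ : Quotient (st Agent)) = ⟦u⟧ := Quotient.sound hu
      have hP : ∀ x : W Agent, ((Tr.cls ⟦x⟧, hist x) : Tr Agent × Set (Tr Agent)) ∈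
          {p : (PM Agent).Tree × Set (PM Agent).Tree | (PM Agent).IsHist p.2 ∧ p.1 ∈ p.2 ∧
          (PM Agent).Sat A p.1 p.2} ↔ x.1 A := by
        intro x
        rw [← ih x]
        exact ⟨fun h => h.2.2, fun h => ⟨hist_max x, rfl, h⟩⟩
      constructor
      · rintro ⟨v, _, e2, B, hB, hB2⟩
        cases hist_inj e2
        exact (imag_congr (fun x => (hP x).symm.trans (hB2 x)) _).2 hB
      · intro h
        exact ⟨u, by rw [e], rfl, A, h, hP⟩
    constructor
    · intro h
      exact (key w (Setoid.refl _)).1 (h.1 _ ((cell_iff _ _ _).2 ⟨w, rfl, fun _ => Iff.rfl⟩))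
    · intro h
      obtain ⟨h1, h2⟩ := (w.2.1.conj _ _).1 (w.mp (Prov.a5 a A) h)
      constructor
      · intro h' hh'
        obtain ⟨u, rfl, hu⟩ := (cell_iff _ _ _).1 hh'
        exact (key u hu.box).2 (u.mp (Prov.cT a _) ((hu _).1 h1))
      · obtain ⟨u, hu, hu2⟩ := s5box.ex w _ ((w.2.1.neg _).1 h2)
        exact ⟨hist u, (Hm_iff _ _).2 ⟨u, rfl, Quotient.sound hu⟩, fun hh => hu2 ((key u hu).1 hh)⟩

end SC

/-- Strong completeness of L: every L-consistent set of sentences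
    has a model, i.e. is satisfied at some moment-history pair of some imagination model. -/
theorem strong_completeness (Agent : Type) [Fintype Agent]
    (Θ : Set (Form Agent)) (hcon : Consistent Θ) :
    ∃ (M : IModel Agent) (m : M.Tree) (h : Set M.Tree),
      h ∈ M.toPreModel.Hm m ∧ ∀ A ∈ Θ, M.toPreModel.Sat A m h := by
  obtain ⟨w, hw⟩ := SC.lind (Γ := Θ) fun h => hcon h.list
  have : Nonempty (SC.W Agent) := ⟨w⟩
  exact ⟨SC.IM Agent, SC.Tr.cls ⟦w⟧, SC.hist w, (SC.Hm_iff _ _).2 ⟨w, rfl, rfl⟩,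
    fun A hA => (SC.truth A w).2 (hw A hA)⟩
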